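/- arXiv:1912.07302 — 6 statements merged into one kernel-verified Lean document; each statement's English description precedes it below -/
import Mathlib

section
/- Let G be a finite simple graph and suppose there exists an integer λ such that the nullity over ℝ of A(G) − λI equals the zero forcing number Z(G). Then for every field F, the matrix A(G) − λI (with its integer entries interpreted in F via the canonical ring homomorphism ℤ → F) has rank over F equal to |G| − Z(G), this common value equals the minimum rank mr(F,G), and consequently M(F,G) = Z(G) for every field F (i.e., G has field independent minimum rank and A(G) − λI is a universally optimal matrix). -/
open scoped Classical

noncomputable section

namespace Paper

variable {V : Type*}

/-- The set of vertices eventually colored blue starting from `Z` under the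
zero forcing color change rule. -/
inductive Forced (G : SimpleGraph V) (Z : Set V) : V → Prop
  | init (v : V) : v ∈ Z → Forced G Z v
  | force (u w : V) : Forced G Z u → G.Adj u w →
      (∀ x, G.Adj u x → x ≠ w → Forced G Z x) → Forced G Z w

/-- `Z` is a zero forcing set of `G`. -/
def IsZeroForcingSet (G : SimpleGraph V) (Z : Set V) : Prop := ∀ v, Forced G Z v

/-- The zero forcing number `Z(G)`. -/
def zfn (G : SimpleGraph V) : ℕ :=
  sInf {m | ∃ Z : Set V, Z.ncard = m ∧ IsZeroForcingSet G Z}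

/-- Membership in the set `S(F,G)` of symmetric matrices described by `G`. -/
def SMat (F : Type*) [Field F] (G : SimpleGraph V) (A : Matrix V V F) : Prop :=
  A.IsSymm ∧ ∀ i j : V, i ≠ j → (A i j ≠ 0 ↔ G.Adj i j)

/-- Maximum nullity `M(F,G)`. -/
def maxNullity (F : Type*) [Field F] [Fintype V] (G : SimpleGraph V) : ℕ :=
  sSup {m | ∃ A : Matrix V V F, SMat F G A ∧ Fintype.card V - A.rank = m}

/-- Minimum rank `mr(F,G)`. -/
def minRank (F : Type*) [Field F] [Fintype V] (G : SimpleGraph V) : ℕ :=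
  sInf {m | ∃ A : Matrix V V F, SMat F G A ∧ A.rank = m}

/-- The Strong Arnold Property. -/
def HasSAP [Fintype V] [DecidableEq V] (A : Matrix V V ℝ) : Prop :=
  ∀ X : Matrix V V ℝ, X.IsSymm → A * X = 0 → Matrix.hadamard A X = 0 →
    Matrix.hadamard (1 : Matrix V V ℝ) X = 0 → X = 0

/-- The Colin de Verdière type parameter `ξ(G)`. -/
def xi [Fintype V] [DecidableEq V] (G : SimpleGraph V) : ℕ :=
  sSup {m | ∃ A : Matrix V V ℝ, SMat ℝ G A ∧ HasSAP A ∧ Fintype.card V - A.rank = m}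

/-- The adjacency matrix of `G` with entries in `R`. -/
def adjMat (R : Type*) [Zero R] [One R] (G : SimpleGraph V) : Matrix V V R :=
  Matrix.of fun i j => if G.Adj i j then 1 else 0

/-- Minimum degree `δ(G)`. -/
def minDeg (G : SimpleGraph V) : ℕ :=
  sInf {d | ∃ v : V, (G.neighborSet v).ncard = d}

/-- Vertex connectivity `κ(G)`. -/
def vertexConnectivity [Fintype V] (G : SimpleGraph V) : ℕ :=
  if G = (⊤ : SimpleGraph V) then Fintype.card V - 1
  else sInf {m | ∃ S : Set V, S.ncard = m ∧ ¬ (G.induce Sᶜ).Connected}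

/-- The circulant graph `Circ[n,S]`. -/
def circG (n : ℕ) (S : Set ℕ) : SimpleGraph (ZMod n) :=
  SimpleGraph.fromRel (fun i j => ∃ s ∈ S, j = i + (s : ZMod n))


/-- A matrix of rank `k` over a field has `k` linearly independent rows. -/
theorem exists_linearIndependent_row_submatrix {K m n : Type*} [Field K] [Finite m] [Fintype n]
    (A : Matrix m n K) {k : ℕ} (hk : A.rank = k) :
    ∃ r : Fin k → m, LinearIndependent K (A.submatrix r id).row := by
  rw [A.rank_eq_finrank_span_row] at hk
  subst hk
  obtain ⟨f, hf, -, hli⟩ := Submodule.exists_fun_fin_finrank_span_eq K (Set.range A.row)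
  choose r hr using hf
  exact ⟨r, (funext hr : (A.submatrix r id).row = f) ▸ hli⟩

/-- A matrix over a field has a nonsingular square submatrix whose size is its rank. -/
theorem exists_submatrix_det_ne_zero {K m n : Type*} [Field K] [Fintype m] [Fintype n]
    (A : Matrix m n K) :
    ∃ (r : Fin A.rank → m) (c : Fin A.rank → n), (A.submatrix r c).det ≠ 0 := by
  obtain ⟨r, hr⟩ := exists_linearIndependent_row_submatrix A rfl
  have hrank : (A.submatrix r id).transpose.rank = A.rank := by
    rw [Matrix.rank_transpose, hr.rank_matrix, Fintype.card_fin]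
  obtain ⟨c, hc⟩ := exists_linearIndependent_row_submatrix (A.submatrix r id).transpose hrank
  have hunit : IsUnit (A.submatrix r c) := Matrix.linearIndependent_cols_iff_isUnit.mp hc
  exact ⟨r, c, ((Matrix.isUnit_iff_isUnit_det _).mp hunit).ne_zero⟩

/-- Passing to a field along an arbitrary ring homomorphism does not increase the rank beyond
the rank over a field containing the ring. -/
theorem rank_map_le_rank_map_of_injective {R K L m n : Type*} [CommRing R] [Field K] [Field L]
    [Fintype m] [Fintype n] (A : Matrix m n R) (f : R →+* K) (g : R →+* L)
    (hf : Function.Injective f) : (A.map g).rank ≤ (A.map f).rank := by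
  obtain ⟨r, c, hdet⟩ := exists_submatrix_det_ne_zero (A.map g)
  have hR : (A.submatrix r c).det ≠ 0 := by
    intro h0
    apply hdet
    have := g.map_det (A.submatrix r c)
    rw [h0, map_zero] at this
    exact this.symm
  have hK : ((A.map f).submatrix r c).det ≠ 0 := by
    have := f.map_det (A.submatrix r c)
    exact fun h0 => hR ((map_eq_zero_iff f hf).mp (this.trans h0))
  simpa [Matrix.rank_of_det_ne_zero hK] using Matrix.rank_submatrix_le (A.map f) r c

/-- A null vector vanishing on `Z` vanishes on every vertex forced by `Z`. -/
theorem Forced.apply_eq_zero {F : Type*} [Field F] [Fintype V] {G : SimpleGraph V}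
    {A : Matrix V V F} (hA : SMat F G A) {Z : Set V} {x : V → F} (hx : A.mulVec x = 0)
    (hZ : ∀ v ∈ Z, x v = 0) {v : V} (hv : Forced G Z v) : x v = 0 := by
  induction hv with
  | init v hv => exact hZ v hv
  | force u w _ huw _ hu hother =>
    have hsum : ∑ j, A u j * x j = 0 := congrFun hx u
    rw [Finset.sum_eq_single w] at hsum
    · exact (mul_eq_zero.mp hsum).resolve_left ((hA.2 u w huw.ne).mpr huw)
    · intro j _ hjw
      by_cases hju : j = u
      · rw [hju, hu, mul_zero]
      by_cases hadj : G.Adj u j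
      · rw [hother j hadj hjw, mul_zero]
      · rw [not_not.mp (mt (hA.2 u j (Ne.symm hju)).mp hadj), zero_mul]
    · simp

theorem exists_isZeroForcingSet_ncard_eq_zfn (G : SimpleGraph V) :
    ∃ Z : Set V, Z.ncard = zfn G ∧ IsZeroForcingSet G Z :=
  Nat.sInf_mem (s := {m | ∃ Z : Set V, Z.ncard = m ∧ IsZeroForcingSet G Z})
    ⟨_, Set.univ, rfl, fun v => .init v (Set.mem_univ v)⟩

/-- The zero forcing number bounds the nullity of every matrix described by the graph. -/
theorem card_le_rank_add_zfn {F : Type*} [Field F] [Fintype V] {G : SimpleGraph V}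
    {A : Matrix V V F} (hA : SMat F G A) : Fintype.card V ≤ A.rank + zfn G := by
  obtain ⟨Z, hcard, hZ⟩ := exists_isZeroForcingSet_ncard_eq_zfn G
  let restrict : LinearMap.ker A.mulVecLin →ₗ[F] (Z → F) :=
    (LinearMap.funLeft F F ((↑) : Z → V)).comp (LinearMap.ker A.mulVecLin).subtype
  have hinj : Function.Injective restrict := by
    rw [injective_iff_map_eq_zero]
    intro x hx
    ext v
    exact (hZ v).apply_eq_zero hA (LinearMap.mem_ker.mp x.2) fun w hw => congrFun hx ⟨w, hw⟩
  have hle := LinearMap.finrank_le_finrank_of_injective hinj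
  rw [Module.finrank_fintype_fun_eq_card, ← Nat.card_eq_fintype_card, Nat.card_coe_set_eq,
    hcard] at hle
  have hrn := A.mulVecLin.finrank_range_add_finrank_ker
  rw [Module.finrank_fintype_fun_eq_card] at hrn
  change A.rank + _ = _ at hrn
  lia

theorem sMat_map_adjMat_sub_smul_one [DecidableEq V] (F : Type*) [Field F] (G : SimpleGraph V)
    (lam : ℤ) :
    SMat F G ((adjMat ℤ G - lam • (1 : Matrix V V ℤ)).map (Int.cast : ℤ → F)) := by
  refine ⟨?_, fun i j hij => ?_⟩
  · ext i j
    simp [-zsmul_one, -zsmul_eq_mul, adjMat, Matrix.one_apply, G.adj_comm i j, eq_comm (a := i)]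
  · simp [-zsmul_one, -zsmul_eq_mul, adjMat, hij]

theorem stmt0 [Fintype V] [DecidableEq V] (G : SimpleGraph V) (lam : ℤ)
    (h : Fintype.card V -
        ((adjMat ℤ G - lam • (1 : Matrix V V ℤ)).map (Int.cast : ℤ → ℝ)).rank = zfn G) :
    ∀ (F : Type) [Field F],
      ((adjMat ℤ G - lam • (1 : Matrix V V ℤ)).map (Int.cast : ℤ → F)).rank
          = Fintype.card V - zfn G ∧
      minRank F G = Fintype.card V - zfn G ∧
      maxNullity F G = zfn G := by
  intro F _
  set B := (adjMat ℤ G - lam • (1 : Matrix V V ℤ)).map (Int.cast : ℤ → F)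
  have hBS : SMat F G B := sMat_map_adjMat_sub_smul_one F G lam
  have hle : B.rank ≤ ((adjMat ℤ G - lam • (1 : Matrix V V ℤ)).map (Int.cast : ℤ → ℝ)).rank :=
    rank_map_le_rank_map_of_injective _ (Int.castRingHom ℝ) (Int.castRingHom F)
      Int.cast_injective
  have hcard := Matrix.rank_le_card_width
    ((adjMat ℤ G - lam • (1 : Matrix V V ℤ)).map (Int.cast : ℤ → ℝ))
  have hlow := card_le_rank_add_zfn hBS
  have hrank : B.rank = Fintype.card V - zfn G := by lia
  refine ⟨hrank, IsLeast.csInf_eq ⟨⟨B, hBS, hrank⟩, ?_⟩,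
    IsGreatest.csSup_eq ⟨⟨B, hBS, by lia⟩, ?_⟩⟩
  · rintro _ ⟨A, hA, rfl⟩
    have := card_le_rank_add_zfn hA
    lia
  · rintro _ ⟨A, hA, rfl⟩
    have := card_le_rank_add_zfn hA
    lia

end Paper
end
end

section
/- For every positive integer r and every field F, M(F, P(15r,2)) = Z(P(15r,2)) = 6 and M(F, P(24r,5)) = Z(P(24r,5)) = 12; moreover the graphs P(15r,2) and P(24r,5) have field independent minimum rank, with their adjacency matrices (shifted by a suitable integer multiple of the identity) universally optimal. -/
open scoped Classical

noncomputable section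

namespace Paper

variable {V : Type*}

/-- The generalized Petersen graph `P(n,k)`: `(false, i)` is the outer vertex `uᵢ`
and `(true, i)` is the inner vertex `vᵢ`. -/
def genPetersen (n k : ℕ) : SimpleGraph (Bool × ZMod n) :=
  SimpleGraph.fromRel (fun a b =>
    (a.1 = false ∧ b.1 = false ∧ b.2 = a.2 + 1) ∨
    (a.1 = true ∧ b.1 = true ∧ b.2 = a.2 + (k : ZMod n)) ∨
    (a.1 = false ∧ b.1 = true ∧ a.2 = b.2))

/-- A kernel vector of a matrix in `S(F,G)` that vanishes on `Z` vanishes on every vertex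
forced by `Z`. -/
theorem eq_zero_of_forced {F : Type*} [Field F] [Fintype V] {G : SimpleGraph V} {Z : Set V}
    {A : Matrix V V F} (hA : SMat F G A) {x : V → F} (hx : A.mulVec x = 0)
    (hZ : ∀ v ∈ Z, x v = 0) {v : V} (hv : Forced G Z v) : x v = 0 := by
  induction hv with
  | init v hv => exact hZ v hv
  | force u w _ huw _ ihu ihx =>
    have hsum : ∑ j, A u j * x j = 0 := congrFun hx u
    rw [Finset.sum_eq_single w] at hsum
    · exact (mul_eq_zero.mp hsum).resolve_left ((hA.2 u w huw.ne).mpr huw)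
    · intro j _ hjw
      by_cases hju : j = u
      · rw [hju, ihu, mul_zero]
      · by_cases hadj : G.Adj u j
        · rw [ihx j hadj hjw, mul_zero]
        · rw [not_not.mp (mt (hA.2 u j (Ne.symm hju)).mp hadj), zero_mul]
    · simp

/-- The nullity of a matrix in `S(F,G)` is at most the size of any zero forcing set. -/
theorem card_sub_rank_le_ncard {F : Type*} [Field F] [Fintype V] {G : SimpleGraph V} {Z : Set V}
    {A : Matrix V V F} (hA : SMat F G A) (hZ : IsZeroForcingSet G Z) :
    Fintype.card V - A.rank ≤ Z.ncard := by
  have hrn := A.mulVecLin.finrank_range_add_finrank_ker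
  rw [Module.finrank_fintype_fun_eq_card] at hrn
  have hker : Module.finrank F (LinearMap.ker A.mulVecLin) ≤ Module.finrank F (Z → F) := by
    refine LinearMap.finrank_le_finrank_of_injective
      (f := (LinearMap.funLeft F F (Subtype.val : Z → V)).comp
        (LinearMap.ker A.mulVecLin).subtype) ?_
    rw [← LinearMap.ker_eq_bot, LinearMap.ker_eq_bot']
    rintro ⟨x, hx⟩ h0
    ext v
    exact eq_zero_of_forced hA hx (fun v hv => congrFun h0 ⟨v, hv⟩) (hZ v)
  rw [Module.finrank_fintype_fun_eq_card, ← Nat.card_eq_fintype_card,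
    Nat.card_coe_set_eq] at hker
  change A.rank + _ = _ at hrn
  omega

/-- The adjacency matrix shifted by an integer, viewed over a field. -/
def shiftedAdj (F : Type*) [Field F] [DecidableEq V] (G : SimpleGraph V) (lam : ℤ) :
    Matrix V V F :=
  (adjMat ℤ G - lam • 1).map (Int.cast : ℤ → F)

theorem shiftedAdj_apply (F : Type*) [Field F] [DecidableEq V] (G : SimpleGraph V) (lam : ℤ)
    (i j : V) : shiftedAdj F G lam i j =
      (if G.Adj i j then 1 else 0) - if i = j then (lam : F) else 0 := by
  simp only [shiftedAdj, adjMat, Matrix.map_apply, Matrix.sub_apply, Matrix.of_apply,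
    Matrix.smul_apply, Matrix.one_apply]
  split_ifs <;> simp

theorem sMat_shiftedAdj (F : Type*) [Field F] [DecidableEq V] (G : SimpleGraph V) (lam : ℤ) :
    SMat F G (shiftedAdj F G lam) := by
  constructor
  · ext i j
    simp only [Matrix.transpose_apply, shiftedAdj_apply, G.adj_comm i j, eq_comm (a := i)]
  · intro i j hij
    simp [shiftedAdj_apply, hij]

/-- If a shift of the adjacency matrix has nullity at least `m` over `F`, and `G` has a zero
forcing set of size at most `m`, then that matrix attains the maximum nullity `m`. -/
theorem nullity_parameters_of_rank_le [Fintype V] [DecidableEq V] {G : SimpleGraph V} {m : ℕ}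
    {Z : Set V} (hm : m ≤ Fintype.card V) (hZ : IsZeroForcingSet G Z) (hZm : Z.ncard ≤ m)
    {lam : ℤ} (F : Type*) [Field F]
    (hrank : (shiftedAdj F G lam).rank ≤ Fintype.card V - m) :
    maxNullity F G = m ∧ zfn G = m ∧ minRank F G = Fintype.card V - m ∧
      (shiftedAdj F G lam).rank = minRank F G := by
  have hS := sMat_shiftedAdj F G lam
  have hup : ∀ A : Matrix V V F, SMat F G A → Fintype.card V - A.rank ≤ m :=
    fun A hA => (card_sub_rank_le_ncard hA hZ).trans hZm
  have heq : (shiftedAdj F G lam).rank = Fintype.card V - m := by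
    have := hup _ hS
    omega
  have hmin : minRank F G = Fintype.card V - m := by
    refine le_antisymm (Nat.sInf_le ⟨_, hS, heq⟩) (le_csInf ⟨_, _, hS, heq⟩ ?_)
    rintro _ ⟨A, hA, rfl⟩
    have := hup A hA
    omega
  refine ⟨?_, ?_, hmin, heq.trans hmin.symm⟩
  · refine IsGreatest.csSup_eq ⟨⟨_, hS, by omega⟩, ?_⟩
    rintro _ ⟨A, hA, rfl⟩
    exact hup A hA
  · refine le_antisymm
      (le_trans (Nat.sInf_le (m := Z.ncard) ⟨Z, rfl, hZ⟩) hZm) (le_csInf ⟨Z.ncard, Z, rfl, hZ⟩ ?_)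
    rintro _ ⟨Y, rfl, hY⟩
    have := card_sub_rank_le_ncard hS hY
    omega

theorem rank_le_of_linearIndependent_ker {F : Type*} [Field F] [Fintype V] {A : Matrix V V F}
    {m : ℕ} {x : Fin m → V → F} (hx : LinearIndependent F x) (hker : ∀ j, A.mulVec (x j) = 0) :
    A.rank ≤ Fintype.card V - m := by
  have hrn := A.mulVecLin.finrank_range_add_finrank_ker
  rw [Module.finrank_fintype_fun_eq_card] at hrn
  have hli : LinearIndependent F
      (fun j => (⟨x j, hker j⟩ : LinearMap.ker A.mulVecLin)) :=
    LinearIndependent.of_comp (LinearMap.ker A.mulVecLin).subtype hx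
  have hle := hli.fintype_card_le_finrank
  rw [Fintype.card_fin] at hle
  change A.rank + _ = _ at hrn
  omega

section GenPetersen

variable {n k : ℕ}

theorem genPetersen_adj_outer (h1 : (1 : ZMod n) ≠ 0) (i j : ZMod n) :
    (genPetersen n k).Adj (false, i) (false, j) ↔ j = i + 1 ∨ j = i - 1 := by
  simp only [genPetersen, SimpleGraph.fromRel_adj]
  grind

theorem genPetersen_adj_inner (hk : (k : ZMod n) ≠ 0) (i j : ZMod n) :
    (genPetersen n k).Adj (true, i) (true, j) ↔ j = i + k ∨ j = i - k := by
  simp only [genPetersen, SimpleGraph.fromRel_adj]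
  grind

theorem genPetersen_adj_spoke (i j : ZMod n) :
    (genPetersen n k).Adj (false, i) (true, j) ↔ j = i := by
  simp only [genPetersen, SimpleGraph.fromRel_adj]
  grind

theorem genPetersen_adj_spoke' (i j : ZMod n) :
    (genPetersen n k).Adj (true, i) (false, j) ↔ j = i := by
  rw [SimpleGraph.adj_comm, genPetersen_adj_spoke, eq_comm]

/-- The outer vertices `u₀, …, u_{2k+1}`. -/
def outerSegment (n k : ℕ) : Set (Bool × ZMod n) :=
  ((Finset.range (2 * k + 2)).image fun i : ℕ => (false, (i : ZMod n)) : Finset (Bool × ZMod n))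

theorem ncard_outerSegment_le : (outerSegment n k).ncard ≤ 2 * k + 2 := by
  rw [outerSegment, Set.ncard_coe_finset]
  exact Finset.card_image_le.trans (Finset.card_range _).le

theorem isZeroForcingSet_outerSegment [NeZero n] (h1 : (1 : ZMod n) ≠ 0)
    (hk : (k : ZMod n) ≠ 0) : IsZeroForcingSet (genPetersen n k) (outerSegment n k) := by
  have hkpos : 1 ≤ k := Nat.one_le_iff_ne_zero.mpr (by rintro rfl; simp at hk)
  set P : Bool → ℕ → Prop :=
    fun b i => Forced (genPetersen n k) (outerSegment n k) (b, (i : ZMod n)) with hP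
  have spoke : ∀ i, P false i → P false (i + 1) → P false (i + 2) → P true (i + 1) := by
    intro i h0 h1' h2
    refine Forced.force _ _ h1' ((genPetersen_adj_spoke _ _).mpr rfl) ?_
    rintro ⟨_ | _, j⟩ hadj hne
    · rw [genPetersen_adj_outer h1] at hadj
      rcases hadj with rfl | rfl
      · convert h2 using 2
        push_cast; ring
      · convert h0 using 2
        push_cast; ring
    · rw [genPetersen_adj_spoke] at hadj
      exact absurd (by rw [hadj]) hne
  have inner : ∀ i, P true i → P false (i + k) → P true (i + k) → P true (i + k + k) := by
    intro i h0 h1' h2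
    refine Forced.force _ _ h2
      ((genPetersen_adj_inner hk _ _).mpr (Or.inl (by push_cast; ring))) ?_
    rintro ⟨_ | _, j⟩ hadj hne
    · rw [genPetersen_adj_spoke'] at hadj
      rwa [hadj]
    · rw [genPetersen_adj_inner hk] at hadj
      rcases hadj with rfl | rfl
      · exact absurd (by push_cast; ring_nf) hne
      · convert h0 using 2
        push_cast; ring
  have outer : ∀ i, P false i → P false (i + 1) → P true (i + 1) → P false (i + 2) := by
    intro i h0 h1' h2
    refine Forced.force _ _ h1'
      ((genPetersen_adj_outer h1 _ _).mpr (Or.inl (by push_cast; ring))) ?_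
    rintro ⟨_ | _, j⟩ hadj hne
    · rw [genPetersen_adj_outer h1] at hadj
      rcases hadj with rfl | rfl
      · exact absurd (by push_cast; ring_nf) hne
      · convert h0 using 2
        push_cast; ring
    · rw [genPetersen_adj_spoke] at hadj
      rwa [hadj]
  have hout : ∀ i, P false i := by
    intro i
    induction i using Nat.strong_induction_on with
    | _ i ih =>
      rcases lt_or_ge i (2 * k + 2) with hi | hi
      · refine Forced.init _ ?_
        simp only [outerSegment, Finset.coe_image, Set.mem_image, Finset.mem_coe,
          Finset.mem_range]
        exact ⟨i, hi, rfl⟩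
      · obtain ⟨m, rfl⟩ := Nat.exists_eq_add_of_le' hi
        have hin : ∀ j, j + 2 < m + (2 * k + 2) → P true (j + 1) := fun j hj =>
          spoke j (ih _ (by omega)) (ih _ (by omega)) (ih _ hj)
        have hv : P true (m + 1 + k + k) := by
          refine inner (m + 1) (hin m (by omega)) (ih _ (by omega)) ?_
          have := hin (m + k) (by omega)
          rwa [show m + 1 + k = m + k + 1 by ring]
        have := outer (m + 2 * k) (ih _ (by omega)) (ih _ (by omega))
          (by rwa [show m + 2 * k + 1 = m + 1 + k + k by ring])
        rwa [← add_assoc]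
  have hall : ∀ b i, P b i := by
    rintro (_ | _) i
    · exact hout i
    · have := spoke (i + n - 1) (hout _) (hout _) (hout _)
      rw [Nat.sub_add_cancel (le_add_left NeZero.one_le)] at this
      simpa [hP] using this
  rintro ⟨b, i⟩
  simpa [hP] using hall b i.val

theorem shiftedAdj_mulVec_outer [NeZero n] {F : Type*} [Field F] (h1 : (1 : ZMod n) ≠ 0)
    (h2 : (2 : ZMod n) ≠ 0) (lam : ℤ) (x : Bool × ZMod n → F) (i : ZMod n) :
    (shiftedAdj F (genPetersen n k) lam).mulVec x (false, i) =
      x (false, i + 1) + x (false, i - 1) + x (true, i) - lam * x (false, i) := by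
  have hne : i - 1 ≠ i + 1 := fun h => h2 (by linear_combination -h)
  have hsplit : ∀ j, (if j = i + 1 ∨ j = i - 1 then x (false, j) else 0) =
      (if j = i + 1 then x (false, j) else 0) + (if j = i - 1 then x (false, j) else 0) := by
    intro j
    by_cases hj : j = i + 1
    · simp [hj, hne.symm]
    · simp [hj]
  simp only [Matrix.mulVec, dotProduct, shiftedAdj_apply, Fintype.sum_prod_type, Fintype.sum_bool,
    genPetersen_adj_outer h1, genPetersen_adj_spoke, sub_mul,
    Finset.sum_sub_distrib, ite_mul, one_mul, zero_mul,
    hsplit, Finset.sum_add_distrib]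
  simp
  ring

theorem shiftedAdj_mulVec_inner [NeZero n] {F : Type*} [Field F] (hk : (k : ZMod n) ≠ 0)
    (h2k : (2 * k : ZMod n) ≠ 0) (lam : ℤ) (x : Bool × ZMod n → F) (i : ZMod n) :
    (shiftedAdj F (genPetersen n k) lam).mulVec x (true, i) =
      x (true, i + k) + x (true, i - k) + x (false, i) - lam * x (true, i) := by
  have hne : i - k ≠ i + k := fun h => h2k (by linear_combination -h)
  have hsplit : ∀ j, (if j = i + k ∨ j = i - k then x (true, j) else 0) =
      (if j = i + k then x (true, j) else 0) + (if j = i - k then x (true, j) else 0) := by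
    intro j
    by_cases hj : j = i + k
    · simp [hj, hne.symm]
    · simp [hj]
  simp only [Matrix.mulVec, dotProduct, shiftedAdj_apply, Fintype.sum_prod_type, Fintype.sum_bool,
    genPetersen_adj_inner hk, genPetersen_adj_spoke', sub_mul,
    Finset.sum_sub_distrib, ite_mul, one_mul, zero_mul,
    hsplit, Finset.sum_add_distrib]
  simp

/-- An integral kernel vector `(g, h)` of `A(P(p,k)) - lam` for which `g` has a run of `2k+1`
zeros followed by a one lifts, together with its shifts, to `2k+2` independent kernel vectors
over every field and for every multiple `n` of `p`. -/
theorem rank_shiftedAdj_genPetersen_le [NeZero n] {F : Type*} [Field F] {p : ℕ} (hpn : p ∣ n)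
    (h1 : (1 : ZMod n) ≠ 0) (h2 : (2 : ZMod n) ≠ 0) (hk : (k : ZMod n) ≠ 0)
    (h2k : (2 * k : ZMod n) ≠ 0) (lam : ℤ) (g h : ZMod p → ℤ)
    (houter : ∀ t, g (t + 1) + g (t - 1) + h t - lam * g t = 0)
    (hinner : ∀ t, h (t + k) + h (t - k) + g t - lam * h t = 0)
    (hone : g 0 = 1) (hzero : ∀ s < 2 * k + 1, g (-((s + 1 : ℕ) : ZMod p)) = 0) :
    (shiftedAdj F (genPetersen n k) lam).rank
      ≤ Fintype.card (Bool × ZMod n) - (2 * k + 2) := by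
  set π := ZMod.castHom hpn (ZMod p) with hπ
  let x : Fin (2 * k + 2) → Bool × ZMod n → F := fun j v =>
    ((if v.1 then h (π v.2 - (j : ℕ)) else g (π v.2 - (j : ℕ)) : ℤ) : F)
  refine rank_le_of_linearIndependent_ker (x := x) ?_ ?_
  · let M : Matrix (Fin (2 * k + 2)) (Fin (2 * k + 2)) F :=
      fun j i => x j (false, ((i : ℕ) : ZMod n))
    have htri : M.BlockTriangular id := by
      intro j i hij
      obtain ⟨s, hs⟩ := Nat.exists_eq_add_of_lt (show (i : ℕ) < (j : ℕ) from hij)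
      have hz := hzero s (by omega)
      have harg : ((i : ℕ) : ZMod p) - ((j : ℕ) : ZMod p) = -((s + 1 : ℕ) : ZMod p) := by
        rw [hs]; push_cast; ring
      simp only [M, x, map_natCast, Bool.false_eq_true, if_false]
      rw [harg, hz, Int.cast_zero]
    have hdet : M.det = 1 := by
      rw [Matrix.det_of_isUpperTriangular htri]
      exact Finset.prod_eq_one fun i _ => by simp [M, x, hone]
    have hM : LinearIndependent F M.row :=
      Matrix.linearIndependent_rows_of_isUnit
        ((Matrix.isUnit_iff_isUnit_det M).mpr (by rw [hdet]; exact isUnit_one))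
    exact LinearIndependent.of_comp
      (LinearMap.funLeft F F fun i : Fin (2 * k + 2) => (false, ((i : ℕ) : ZMod n))) hM
  · intro j
    ext ⟨_ | _, i⟩
    · rw [shiftedAdj_mulVec_outer h1 h2]
      have := congrArg (Int.cast : ℤ → F) (houter (π i - (j : ℕ)))
      simp only [x, map_add, map_sub, map_one, Bool.false_eq_true, if_false, if_true]
      rw [sub_add_eq_add_sub, sub_right_comm] at this
      exact_mod_cast this
    · rw [shiftedAdj_mulVec_inner hk h2k]
      have := congrArg (Int.cast : ℤ → F) (hinner (π i - (j : ℕ)))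
      simp only [x, map_add, map_sub, map_natCast, Bool.false_eq_true, if_false, if_true]
      rw [sub_add_eq_add_sub, sub_right_comm] at this
      exact_mod_cast this

theorem natCast_ne_zero_of_lt {m : ℕ} (h0 : 0 < m) (hm : m < n) : (m : ZMod n) ≠ 0 := by
  rw [Ne, ZMod.natCast_eq_zero_iff]
  exact Nat.not_dvd_of_pos_of_lt h0 hm

theorem genPetersen_nullity_parameters [NeZero n] {p : ℕ} (hpn : p ∣ n) (hk0 : 0 < k)
    (hkn : 2 * k + 2 ≤ n) (lam : ℤ) (g h : ZMod p → ℤ)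
    (houter : ∀ t, g (t + 1) + g (t - 1) + h t - lam * g t = 0)
    (hinner : ∀ t, h (t + k) + h (t - k) + g t - lam * h t = 0)
    (hone : g 0 = 1) (hzero : ∀ s < 2 * k + 1, g (-((s + 1 : ℕ) : ZMod p)) = 0)
    (F : Type*) [Field F] :
    maxNullity F (genPetersen n k) = 2 * k + 2 ∧ zfn (genPetersen n k) = 2 * k + 2 ∧
      minRank F (genPetersen n k) = Fintype.card (Bool × ZMod n) - (2 * k + 2) ∧
      (shiftedAdj F (genPetersen n k) lam).rank = minRank F (genPetersen n k) := by
  have h1 : (1 : ZMod n) ≠ 0 := by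
    simpa using natCast_ne_zero_of_lt (n := n) one_pos (by omega)
  have h2 : (2 : ZMod n) ≠ 0 := by
    simpa using natCast_ne_zero_of_lt (n := n) two_pos (by omega)
  have hk : (k : ZMod n) ≠ 0 := natCast_ne_zero_of_lt hk0 (by omega)
  have h2k : (2 * k : ZMod n) ≠ 0 := by
    simpa using natCast_ne_zero_of_lt (n := n) (m := 2 * k) (by omega) (by omega)
  have hcard : 2 * k + 2 ≤ Fintype.card (Bool × ZMod n) := by
    rw [Fintype.card_prod, Fintype.card_bool, ZMod.card]
    omega
  exact nullity_parameters_of_rank_le hcard (isZeroForcingSet_outerSegment h1 hk)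
    ncard_outerSegment_le F
    (rank_shiftedAdj_genPetersen_le hpn h1 h2 hk h2k lam g h houter hinner hone hzero)

end GenPetersen

/-- The outer part of a kernel vector of `A(P(15,2)) + 2`. -/
def outerVec15 : ZMod 15 → ℤ := ![1, -2, 1, 1, -2, 2, -1, -1, 2, -1, 0, 0, 0, 0, 0]

/-- The inner part of a kernel vector of `A(P(15,2)) + 2`. -/
def innerVec15 : ZMod 15 → ℤ := ![0, 2, -1, -1, 1, -1, 1, 1, -2, 0, 1, 0, 0, 0, -1]

/-- The outer part of a kernel vector of `A(P(24,5))`. -/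
def outerVec24 : ZMod 24 → ℤ :=
  ![1, 0, -1, 0, 1, 0, 0, 0, -1, 0, 1, 0, -1, 0, 0, 0, 0, 0, 0, 0, 0, 0, 0, 0]

/-- The inner part of a kernel vector of `A(P(24,5))`. -/
def innerVec24 : ZMod 24 → ℤ :=
  ![0, 0, 0, 0, 0, -1, 0, 1, 0, 0, 0, 0, 0, 1, 0, 0, 0, 0, 0, 0, 0, 0, 0, -1]

theorem genPetersen_two_nullity_parameters {n : ℕ} [NeZero n] (hn : 15 ∣ n) (F : Type*) [Field F] :
    maxNullity F (genPetersen n 2) = 6 ∧ zfn (genPetersen n 2) = 6 ∧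
      minRank F (genPetersen n 2) = Fintype.card (Bool × ZMod n) - 6 ∧
      (shiftedAdj F (genPetersen n 2) (-2)).rank = minRank F (genPetersen n 2) :=
  genPetersen_nullity_parameters hn (by norm_num)
    (le_trans (by norm_num) (Nat.le_of_dvd (NeZero.pos n) hn)) (-2) outerVec15 innerVec15
    (by decide) (by decide) (by decide) (by decide) F

theorem genPetersen_five_nullity_parameters {n : ℕ} [NeZero n] (hn : 24 ∣ n) (F : Type*)
    [Field F] :
    maxNullity F (genPetersen n 5) = 12 ∧ zfn (genPetersen n 5) = 12 ∧
      minRank F (genPetersen n 5) = Fintype.card (Bool × ZMod n) - 12 ∧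
      (shiftedAdj F (genPetersen n 5) 0).rank = minRank F (genPetersen n 5) :=
  genPetersen_nullity_parameters hn (by norm_num)
    (le_trans (by norm_num) (Nat.le_of_dvd (NeZero.pos n) hn)) 0 outerVec24 innerVec24
    (by decide) (by decide) (by decide) (by decide) F

theorem stmt1 (r : ℕ) (hr : 1 ≤ r) :
    haveI : NeZero (15 * r) := ⟨by omega⟩
    haveI : NeZero (24 * r) := ⟨by omega⟩
    (∀ (F : Type) [Field F],
        maxNullity F (genPetersen (15 * r) 2) = 6 ∧
        maxNullity F (genPetersen (24 * r) 5) = 12) ∧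
    zfn (genPetersen (15 * r) 2) = 6 ∧
    zfn (genPetersen (24 * r) 5) = 12 ∧
    (∀ (F : Type) [Field F],
        minRank F (genPetersen (15 * r) 2) = minRank ℝ (genPetersen (15 * r) 2) ∧
        minRank F (genPetersen (24 * r) 5) = minRank ℝ (genPetersen (24 * r) 5)) ∧
    (∃ lam : ℤ, ∀ (F : Type) [Field F],
        ((adjMat ℤ (genPetersen (15 * r) 2) - lam • 1).map (Int.cast : ℤ → F)).rank
          = minRank F (genPetersen (15 * r) 2)) ∧
    (∃ lam : ℤ, ∀ (F : Type) [Field F],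
        ((adjMat ℤ (genPetersen (24 * r) 5) - lam • 1).map (Int.cast : ℤ → F)).rank
          = minRank F (genPetersen (24 * r) 5)) := by
  have : NeZero (15 * r) := ⟨by omega⟩
  have : NeZero (24 * r) := ⟨by omega⟩
  have h15 := fun (F : Type) [Field F] =>
    genPetersen_two_nullity_parameters (dvd_mul_right 15 r) F
  have h24 := fun (F : Type) [Field F] =>
    genPetersen_five_nullity_parameters (dvd_mul_right 24 r) F
  exact ⟨fun F _ => ⟨(h15 F).1, (h24 F).1⟩, (h15 ℝ).2.1, (h24 ℝ).2.1,
    fun F _ => ⟨(h15 F).2.2.1.trans (h15 ℝ).2.2.1.symm, (h24 F).2.2.1.trans (h24 ℝ).2.2.1.symm⟩,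
    ⟨-2, fun F _ => (h15 F).2.2.2⟩, ⟨0, fun F _ => (h24 F).2.2.2⟩⟩

end Paper
end
end

section
/- Let G be a finite bipartite simple graph with bipartition into independent sets B and B̄ with |B| = |B̄|. If u_1,...,u_t is a red sequence all of whose vertices lie in B, and in which for each j the witnessing data v, X, Y consist only of vertices of B, then 2t ≤ null(A(G)), the nullity of the adjacency matrix of G over ℝ. -/
open scoped Classical

noncomputable section

namespace Paper

variable {V : Type*}

/-- The row of the integer adjacency matrix of `G` indexed by `v`. -/
def row (G : SimpleGraph V) (v : V) : V → ℤ := fun w => if G.Adj v w then 1 else 0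

/-- `u` is a red sequence of vertices of `G` all of whose vertices and
witnessing data lie in `B`. -/
def IsRedSeqIn (G : SimpleGraph V) (B : Set V) (u : List V) : Prop :=
  u.Nodup ∧ (∀ w ∈ u, w ∈ B) ∧
  ∀ j : Fin u.length, ∃ (v : V) (X Y : Multiset V) (k : ℕ),
    v ∈ B ∧ (∀ x ∈ X, x ∈ B) ∧ (∀ y ∈ Y, y ∈ B) ∧
    v ∉ u.take j.1 ∧ (∀ x ∈ X, x ∉ u.take j.1) ∧ (∀ y ∈ Y, y ∉ u.take j.1) ∧
    u.get j ≠ v ∧ u.get j ∉ X ∧ u.get j ∉ Y ∧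
    ((k : ℤ) + 1) • row G (u.get j) =
      row G v + (X.map (row G)).sum - (Y.map (row G)).sum

/-- The coordinatewise embedding of integer vectors into real vectors. -/
def castVec (V : Type*) : (V → ℤ) →+ (V → ℝ) := (Int.castAddHom ℝ).compLeft V

theorem sum_map_castVec_row_mem (G : SimpleGraph V) (S : Set V) (X : Multiset V)
    (hX : ∀ x ∈ X, x ∈ S) :
    castVec V (X.map (row G)).sum ∈
      Submodule.span ℝ ((fun v => castVec V (row G v)) '' S) := by
  rw [map_multiset_sum, Multiset.map_map]
  refine multiset_sum_mem _ fun a ha => ?_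
  obtain ⟨x, hx, rfl⟩ := Multiset.mem_map.1 ha
  exact Submodule.subset_span ⟨x, hX x hx, rfl⟩

/-- The rows outside an initial part of a red sequence span all rows of `B`. -/
theorem IsRedSeqIn.row_mem_span_take {G : SimpleGraph V} {B : Set V} {u : List V}
    (hu : IsRedSeqIn G B u) {j : ℕ} (hj : j ≤ u.length) {b : V} (hb : b ∈ B) :
    castVec V (row G b) ∈ Submodule.span ℝ
      ((fun v => castVec V (row G v)) '' {w | w ∈ B ∧ w ∉ u.take j}) := by
  induction j with
  | zero => exact Submodule.subset_span ⟨b, by simpa using hb, rfl⟩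
  | succ j ih =>
    have hjlt : j < u.length := hj
    refine Submodule.span_le.2 ?_ (ih hjlt.le)
    rintro _ ⟨w, ⟨hwB, hw⟩, rfl⟩
    have mem_succ : ∀ x ∈ B, x ∉ u.take j → x ≠ u[j] →
        x ∈ {w | w ∈ B ∧ w ∉ u.take (j + 1)} := by
      intro x hxB hx hne
      refine ⟨hxB, ?_⟩
      rw [List.take_succ_eq_append_getElem hjlt, List.mem_append, List.mem_singleton]
      exact not_or.2 ⟨hx, hne⟩
    by_cases hwj : w = u[j]
    · obtain ⟨v, X, Y, k, hvB, hXB, hYB, hv, hX, hY, hjv, hjX, hjY, h⟩ := hu.2.2 ⟨j, hjlt⟩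
      simp only [List.get_eq_getElem] at hjv hjX hjY h
      have h' := congrArg (castVec V) h
      rw [map_sub, map_add, map_zsmul] at h'
      have hmem : ((k : ℤ) + 1) • castVec V (row G u[j]) ∈ Submodule.span ℝ
          ((fun v => castVec V (row G v)) '' {w | w ∈ B ∧ w ∉ u.take (j + 1)}) := by
        rw [h']
        refine Submodule.sub_mem _ (Submodule.add_mem _ ?_ ?_) ?_
        · exact Submodule.subset_span ⟨v, mem_succ v hvB hv hjv.symm, rfl⟩
        · exact sum_map_castVec_row_mem G _ X fun x hx =>
            mem_succ x (hXB x hx) (hX x hx) fun e => hjX (e ▸ hx)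
        · exact sum_map_castVec_row_mem G _ Y fun y hy =>
            mem_succ y (hYB y hy) (hY y hy) fun e => hjY (e ▸ hy)
      rw [← Int.cast_smul_eq_zsmul ℝ] at hmem
      have hk : (((k : ℤ) + 1 : ℤ) : ℝ) ≠ 0 := by
        have : (0 : ℝ) ≤ k := k.cast_nonneg
        push_cast
        positivity
      rw [hwj]
      exact (Submodule.smul_mem_iff _ hk).1 hmem
    · exact Submodule.subset_span ⟨w, mem_succ w hwB hw hwj, rfl⟩

theorem rank_add_le_add_rank {m n K : Type*} [Finite m] [Fintype n] [Field K]
    (M N : Matrix m n K) : (M + N).rank ≤ M.rank + N.rank := by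
  unfold Matrix.rank
  rw [Matrix.mulVecLin_add]
  exact (Submodule.finrank_mono (LinearMap.range_add_le _ _)).trans
    (Submodule.finrank_add_le_finrank_add_finrank _ _)

/-- The real adjacency matrix of `G` with the rows outside `B` replaced by zero. -/
def partRows (G : SimpleGraph V) (B : Set V) : Matrix V V ℝ :=
  Matrix.of fun i j => if i ∈ B ∧ G.Adj i j then 1 else 0

theorem adjMat_eq_partRows_add_transpose (G : SimpleGraph V) (B : Set V)
    (hB : ∀ u ∈ B, ∀ v ∈ B, ¬ G.Adj u v) (hBc : ∀ u ∉ B, ∀ v ∉ B, ¬ G.Adj u v) :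
    adjMat ℝ G = partRows G B + (partRows G B).transpose := by
  ext i j
  have h₁ := hB i
  have h₂ := hBc i
  simp only [adjMat, partRows, Matrix.add_apply, Matrix.transpose_apply, Matrix.of_apply,
    G.adj_comm j i]
  by_cases hij : G.Adj i j <;> by_cases hi : i ∈ B <;> by_cases hj : j ∈ B <;> simp_all

theorem IsRedSeqIn.rank_partRows_add_length_le [Fintype V] {G : SimpleGraph V} {B : Set V}
    {u : List V} (hu : IsRedSeqIn G B u) : (partRows G B).rank + u.length ≤ B.ncard := by
  have hle : Submodule.span ℝ (Set.range (partRows G B).row) ≤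
      Submodule.span ℝ ((fun v => castVec V (row G v)) '' {w | w ∈ B ∧ w ∉ u}) := by
    rw [Submodule.span_le]
    rintro _ ⟨i, rfl⟩
    by_cases hi : i ∈ B
    · have h : (partRows G B).row i = castVec V (row G i) := by
        ext j
        simp [partRows, castVec, row, hi]
      rw [h]
      simpa using hu.row_mem_span_take le_rfl hi
    · have h : (partRows G B).row i = 0 := by
        ext j
        simp [partRows, hi]
      rw [h]
      exact Submodule.zero_mem _
  have hspan : Module.finrank ℝ (Submodule.span ℝ
      ((fun v => castVec V (row G v)) '' {w | w ∈ B ∧ w ∉ u})) ≤ {w | w ∈ B ∧ w ∉ u}.ncard := by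
    refine (finrank_span_le_card _).trans ?_
    rw [← Set.ncard_eq_toFinset_card']
    exact Set.ncard_image_le
  have hcard : {w | w ∈ B ∧ w ∉ u}.ncard + u.length = B.ncard := by
    rw [← List.toFinset_card_of_nodup hu.1, ← Set.ncard_coe_finset]
    have : {w | w ∈ B ∧ w ∉ u} = B \ (u.toFinset : Set V) := by
      ext w
      simp
    rw [this]
    exact Set.ncard_sdiff_add_ncard_of_subset fun w hw => hu.2.1 w (by simpa using hw)
  rw [Matrix.rank_eq_finrank_span_row]
  have := Submodule.finrank_mono hle
  omega

theorem stmt3 [Fintype V] [DecidableEq V] (G : SimpleGraph V) (B : Set V)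
    (hB : ∀ u ∈ B, ∀ v ∈ B, ¬ G.Adj u v)
    (hBc : ∀ u ∉ B, ∀ v ∉ B, ¬ G.Adj u v)
    (hcard : B.ncard = Bᶜ.ncard)
    (u : List V) (hu : IsRedSeqIn G B u) :
    2 * u.length ≤ Fintype.card V - (adjMat ℝ G).rank := by
  have hrank : (adjMat ℝ G).rank ≤ (partRows G B).rank + (partRows G B).rank := by
    rw [adjMat_eq_partRows_add_transpose G B hB hBc]
    exact (rank_add_le_add_rank _ _).trans_eq (by rw [Matrix.rank_transpose])
  have hlen := hu.rank_partRows_add_length_le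
  have hV := Set.ncard_add_ncard_compl B
  rw [Nat.card_eq_fintype_card] at hV
  omega

end Paper
end
end

section
/- For every positive integer r, the zero forcing number of the Aztec diamond graph satisfies Z(AD_r) ≤ 2r. -/
open scoped Classical

noncomputable section

namespace Paper

variable {V : Type*}

/-- The defining predicate for the vertex set of the Aztec diamond graph. -/
def AztecPred (r : ℕ) (p : ℤ × ℤ) : Prop :=
  1 ≤ p.1 ∧ p.1 ≤ 2 * (r : ℤ) ∧ 1 ≤ p.2 ∧ p.2 ≤ 2 * (r : ℤ) ∧
    (r : ℤ) + 1 ≤ p.1 + p.2 ∧ p.1 + p.2 ≤ 3 * (r : ℤ) + 1 ∧ |p.2 - p.1| ≤ (r : ℤ)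

/-- The Aztec diamond graph `AD_r`. -/
def aztec (r : ℕ) : SimpleGraph {p : ℤ × ℤ // AztecPred r p} :=
  SimpleGraph.fromRel (fun a b => |a.1.1 - b.1.1| + |a.1.2 - b.1.2| = 1)

/-- The north-west staircase `i + j = r + 1` together with the north-east staircase `j - i = r`. -/
def aztecStaircases (r : ℕ) : Finset (ℤ × ℤ) :=
  (Finset.Icc 1 r).image (fun i : ℕ => ((i : ℤ), (r : ℤ) + 1 - i)) ∪
    (Finset.Icc 1 r).image (fun i : ℕ => ((i : ℤ), (r : ℤ) + i))

theorem card_aztecStaircases_le (r : ℕ) : (aztecStaircases r).card ≤ 2 * r := by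
  have h (f : ℕ → ℤ × ℤ) : ((Finset.Icc 1 r).image f).card ≤ r :=
    Finset.card_image_le.trans (by simp)
  calc (aztecStaircases r).card ≤ _ := Finset.card_union_le _ _
    _ ≤ r + r := add_le_add (h _) (h _)
    _ = 2 * r := by ring

theorem mem_aztecStaircases {r : ℕ} {p : ℤ × ℤ} (hp : AztecPred r p)
    (h : p.1 + p.2 = r + 1 ∨ p.2 - p.1 = r) : p ∈ aztecStaircases r := by
  obtain ⟨i, j⟩ := p
  obtain ⟨h1, -, h3, h4, -, -, -⟩ := hp
  simp only [aztecStaircases, Finset.mem_union, Finset.mem_image, Finset.mem_Icc, Prod.mk.injEq]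
  dsimp only at *
  exact h.imp (fun h => ⟨i.toNat, by omega⟩) (fun h => ⟨i.toNat, by omega⟩)

theorem aztec_adj {r : ℕ} {a b : {p : ℤ × ℤ // AztecPred r p}} :
    (aztec r).Adj a b ↔ |a.1.1 - b.1.1| + |a.1.2 - b.1.2| = 1 := by
  simp only [aztec, SimpleGraph.fromRel_adj, abs_sub_comm b.1.1, abs_sub_comm b.1.2, or_self,
    and_iff_right_iff_imp]
  rintro h rfl
  simp at h

/-- The two staircases force the diamond row by row: each vertex outside them is forced by its
neighbor in the previous row. -/
theorem isZeroForcingSet_aztecStaircases (r : ℕ) :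
    IsZeroForcingSet (aztec r) {v | v.1 ∈ aztecStaircases r} := by
  suffices h : ∀ (n : ℕ) (v : {p : ℤ × ℤ // AztecPred r p}), v.1.1 ≤ n →
      Forced (aztec r) {v | v.1 ∈ aztecStaircases r} v from
    fun v => h v.1.1.toNat v (Int.self_le_toNat _)
  intro n
  induction n with
  | zero => exact fun v hv => absurd (v.2.1.trans hv) (by simp)
  | succ n ih =>
    rintro ⟨⟨i, j⟩, hp⟩ hv
    by_cases hZ : i + j = r + 1 ∨ j - i = r
    · exact .init _ (mem_aztecStaircases hp hZ)
    have hu : AztecPred r (i - 1, j) := by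
      simp only [AztecPred, abs_le] at hp ⊢
      omega
    push_cast at hv
    refine .force ⟨(i - 1, j), hu⟩ _ (ih _ (by dsimp only at *; omega)) ?_ ?_
    · simp [aztec_adj]
    · rintro ⟨⟨k, l⟩, hx⟩ hadj hne
      refine ih _ ?_
      simp only [aztec_adj] at hadj
      simp only [ne_eq, Subtype.mk.injEq, Prod.mk.injEq] at hne
      dsimp only at *
      grind

theorem stmt4 (r : ℕ) (hr : 1 ≤ r) : zfn (aztec r) ≤ 2 * r := by
  
  have h : zfn (aztec r) ≤ Set.ncard {v : {p // AztecPred r p} | v.1 ∈ aztecStaircases r} :=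
    Nat.sInf_le ⟨_, rfl, isZeroForcingSet_aztecStaircases r⟩
  refine h.trans (le_trans ?_ (card_aztecStaircases_le r))
  rw [← Set.ncard_coe_finset]
  exact Set.ncard_le_ncard_of_injOn Subtype.val (fun _ h => h) Subtype.val_injective.injOn
    (Finset.finite_toSet _)

end Paper
end
end

section
/- Let n be a positive multiple of 8. Then the zero forcing number of the circulant graph Circ[n, {1, n/2 − 1}] satisfies Z(Circ[n, {1, n/2 − 1}]) ≤ n/2 + 2. -/
open scoped Classical

noncomputable section

namespace Paper

variable {V : Type*}

/-- In `Circ[2m, {1, m - 1}]` the initial segment `{0, …, m + 1}` is a zero forcing set. -/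
theorem isZeroForcingSet_circG_initial (m : ℕ) (hm : 2 ≤ m) :
    IsZeroForcingSet (circG (2 * m) {1, m - 1}) {x : ZMod (2 * m) | x.val < m + 2} := by
  have hz : (m : ZMod (2 * m)) + m = 0 := by
    have h := ZMod.natCast_self (2 * m)
    push_cast at h
    linear_combination h
  have hc : ((m - 1 : ℕ) : ZMod (2 * m)) = m - 1 := by
    rw [Nat.cast_sub (by omega), Nat.cast_one]
  have hadj : ∀ u x : ZMod (2 * m), (circG (2 * m) {1, m - 1}).Adj u x →
      x = u + 1 ∨ x = u + 1 + m ∨ x = u - 1 ∨ x = u - 1 + m := by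
    intro u x h
    simp only [circG, SimpleGraph.fromRel_adj, Set.mem_insert_iff, Set.mem_singleton_iff,
      exists_eq_or_imp, exists_eq_left, Nat.cast_one, hc] at h
    obtain ⟨-, (h | h) | (h | h)⟩ := h
    · exact Or.inl h
    · right; right; right; linear_combination h
    · right; right; left; linear_combination -h
    · right; left; linear_combination -h - hz
  have hadj' : ∀ u : ZMod (2 * m), (circG (2 * m) {1, m - 1}).Adj u (u + 1 + m) := by
    intro u
    simp only [circG, SimpleGraph.fromRel_adj, Set.mem_insert_iff, Set.mem_singleton_iff,
      exists_eq_or_imp, exists_eq_left, Nat.cast_one, hc]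
    refine ⟨fun h => ?_, Or.inr (Or.inr (by linear_combination -hz))⟩
    have h0 : ((m + 1 : ℕ) : ZMod (2 * m)) = 0 := by
      push_cast
      linear_combination -h
    rw [ZMod.natCast_eq_zero_iff] at h0
    have := Nat.le_of_dvd (by omega) h0
    omega
  have hinit : ∀ j : ℕ, j < m + 2 →
      Forced (circG (2 * m) {1, m - 1}) {x : ZMod (2 * m) | x.val < m + 2} (j : ZMod (2 * m)) :=
    fun j hj => .init _ (by
      rw [Set.mem_ofPred_eq, ZMod.val_natCast]
      exact (Nat.mod_le _ _).trans_lt hj)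
  have hstep : ∀ j : ℕ, j < m →
      Forced (circG (2 * m) {1, m - 1}) {x : ZMod (2 * m) | x.val < m + 2}
        ((j + m : ℕ) : ZMod (2 * m)) := by
    intro j
    induction j using Nat.strong_induction_on with
    | _ j ih =>
      intro hj
      by_cases hj2 : j < 2
      · exact hinit _ (by omega)
      obtain ⟨i, rfl⟩ : ∃ i, j = i + 2 := ⟨j - 2, by omega⟩
      have hw : ((i + 2 + m : ℕ) : ZMod (2 * m)) = ((i + 1 : ℕ) : ZMod (2 * m)) + 1 + m := by
        push_cast
        ring
      rw [hw]
      refine .force _ _ (hinit (i + 1) (by omega)) (hadj' _) fun x hx hne => ?_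
      obtain rfl | rfl | rfl | rfl := hadj _ _ hx
      · exact_mod_cast hinit (i + 1 + 1) (by omega)
      · exact absurd rfl hne
      · convert hinit i (by omega) using 1
        push_cast
        ring
      · convert ih i (by omega) (by omega) using 1
        push_cast
        ring
  intro v
  have : NeZero (2 * m) := ⟨by omega⟩
  have hv := ZMod.val_lt v
  rw [← ZMod.natCast_zmod_val v]
  by_cases hvm : v.val < m
  · exact hinit _ (by omega)
  · have h := hstep (v.val - m) (by omega)
    rwa [Nat.sub_add_cancel (by omega)] at h

theorem ncard_zmod_val_lt_le (n k : ℕ) [NeZero n] : {x : ZMod n | x.val < k}.ncard ≤ k := by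
  have h := Set.ncard_le_ncard_of_injOn (s := {x : ZMod n | x.val < k}) (t := Set.Iio k)
    ZMod.val (fun _ hx => hx) (ZMod.val_injective n).injOn (Set.finite_Iio k)
  simpa [Set.ncard_eq_toFinset_card'] using h

theorem stmt6 (n : ℕ) (hpos : 0 < n) (hn : 8 ∣ n) :
    zfn (circG n {1, n / 2 - 1}) ≤ n / 2 + 2 := by
  obtain ⟨m, rfl⟩ : 2 ∣ n := dvd_trans (by norm_num) hn
  have : NeZero (2 * m) := ⟨by omega⟩
  rw [Nat.mul_div_cancel_left m two_pos]
  refine le_trans ?_ (ncard_zmod_val_lt_le (2 * m) (m + 2))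
  exact Nat.sInf_le ⟨_, rfl, isZeroForcingSet_circG_initial m (by omega)⟩

end Paper
end
end

section
/- For all nonnegative integers t and k, the zero forcing number of the extended cube graph satisfies Z(ECG(t,k)) ≤ 4. -/
open scoped Classical

noncomputable section

namespace Paper

variable {V : Type*}

/-- The extended cube graph `ECG(t,k)` on `n = 2t + 2k + 8` vertices. -/
def ECG (t k : ℕ) : SimpleGraph (ZMod (2 * t + 2 * k + 8)) :=
  SimpleGraph.fromRel (fun a b =>
    b = a + 1 ∨
    (∃ i : ℕ, i ≤ k + 1 ∧ a = (i : ZMod (2 * t + 2 * k + 8)) ∧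
      b = ((2 * t + 2 * k + 8 - t - 3 - i : ℕ) : ZMod (2 * t + 2 * k + 8))) ∨
    (∃ i : ℕ, k + 2 ≤ i ∧ i ≤ t + k + 3 ∧ a = (i : ZMod (2 * t + 2 * k + 8)) ∧
      b = ((2 * t + 2 * k + 8 + k + 1 - i : ℕ) : ZMod (2 * t + 2 * k + 8))))

instance ecgNeZero (t k : ℕ) : NeZero (2 * t + 2 * k + 8) := ⟨by omega⟩

/-- Adjacency in `ECG t k`, read off on the representatives `0, …, 2t + 2k + 7`. -/
def ecgRel (t k a b : ℕ) : Prop :=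
  b = a + 1 ∨ a = b + 1 ∨ (a = 0 ∧ b = 2 * t + 2 * k + 7) ∨ (b = 0 ∧ a = 2 * t + 2 * k + 7) ∨
  (a + b = t + 2 * k + 5 ∧ (a ≤ k + 1 ∨ b ≤ k + 1)) ∨
  (a + b = 2 * t + 3 * k + 9 ∧ (k + 2 ≤ a ∧ a ≤ t + k + 3 ∨ k + 2 ≤ b ∧ b ≤ t + k + 3))

theorem zmod_natCast_inj_of_lt {n a b : ℕ} (ha : a < n) (hb : b < n) :
    (a : ZMod n) = b ↔ a = b := by
  rw [ZMod.natCast_eq_natCast_iff', Nat.mod_eq_of_lt ha, Nat.mod_eq_of_lt hb]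

theorem zmod_natCast_eq_add_one_iff {n a b : ℕ} (ha : a < n) (hb : b < n) :
    (b : ZMod n) = a + 1 ↔ b = a + 1 ∨ (b = 0 ∧ a + 1 = n) := by
  rw [← Nat.cast_succ, ZMod.natCast_eq_natCast_iff', Nat.mod_eq_of_lt hb]
  rcases Nat.lt_or_eq_of_le (Nat.succ_le_of_lt ha) with h | h
  · rw [Nat.mod_eq_of_lt h]; omega
  · rw [h, Nat.mod_self]; omega

theorem ecg_adj_natCast_iff {t k a b : ℕ} (ha : a < 2 * t + 2 * k + 8)
    (hb : b < 2 * t + 2 * k + 8) :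
    (ECG t k).Adj (a : ZMod (2 * t + 2 * k + 8)) (b : ZMod (2 * t + 2 * k + 8)) ↔
      ecgRel t k a b := by
  have vertical : ∀ {c d : ℕ}, c < 2 * t + 2 * k + 8 → d < 2 * t + 2 * k + 8 →
      ((∃ i : ℕ, i ≤ k + 1 ∧ (c : ZMod (2 * t + 2 * k + 8)) = (i : ZMod (2 * t + 2 * k + 8)) ∧
        (d : ZMod (2 * t + 2 * k + 8)) =
          ((2 * t + 2 * k + 8 - t - 3 - i : ℕ) : ZMod (2 * t + 2 * k + 8))) ↔
      c + d = t + 2 * k + 5 ∧ c ≤ k + 1) := by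
    intro c d hc hd
    constructor
    · rintro ⟨i, hi, h, h'⟩
      rw [zmod_natCast_inj_of_lt hc (by omega)] at h
      rw [zmod_natCast_inj_of_lt hd (by omega)] at h'
      omega
    · rintro ⟨h, h'⟩
      refine ⟨c, h', rfl, ?_⟩
      rw [zmod_natCast_inj_of_lt hd (by omega)]
      omega
  have horizontal : ∀ {c d : ℕ}, c < 2 * t + 2 * k + 8 → d < 2 * t + 2 * k + 8 →
      ((∃ i : ℕ, k + 2 ≤ i ∧ i ≤ t + k + 3 ∧
        (c : ZMod (2 * t + 2 * k + 8)) = (i : ZMod (2 * t + 2 * k + 8)) ∧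
        (d : ZMod (2 * t + 2 * k + 8)) =
          ((2 * t + 2 * k + 8 + k + 1 - i : ℕ) : ZMod (2 * t + 2 * k + 8))) ↔
      c + d = 2 * t + 3 * k + 9 ∧ k + 2 ≤ c ∧ c ≤ t + k + 3) := by
    intro c d hc hd
    constructor
    · rintro ⟨i, hi, hi', h, h'⟩
      rw [zmod_natCast_inj_of_lt hc (by omega)] at h
      rw [zmod_natCast_inj_of_lt hd (by omega)] at h'
      omega
    · rintro ⟨h, h', h''⟩
      refine ⟨c, h', h'', rfl, ?_⟩
      rw [zmod_natCast_inj_of_lt hd (by omega)]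
      omega
  rw [ECG, SimpleGraph.fromRel_adj, Ne, zmod_natCast_inj_of_lt ha hb,
    zmod_natCast_eq_add_one_iff ha hb, zmod_natCast_eq_add_one_iff hb ha,
    vertical ha hb, vertical hb ha, horizontal ha hb, horizontal hb ha, ecgRel]
  omega

theorem forced_natCast_of_ecgRel {t k u w : ℕ} {Z : Set (ZMod (2 * t + 2 * k + 8))}
    (hu : u < 2 * t + 2 * k + 8) (hw : w < 2 * t + 2 * k + 8)
    (hF : Forced (ECG t k) Z u) (huw : ecgRel t k u w)
    (h : ∀ x < 2 * t + 2 * k + 8, ecgRel t k u x → x ≠ w → Forced (ECG t k) Z x) :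
    Forced (ECG t k) Z w := by
  refine Forced.force (V := ZMod (2 * t + 2 * k + 8)) u w hF ((ecg_adj_natCast_iff hu hw).2 huw) fun x hx hne => ?_
  rw [← ZMod.natCast_zmod_val x] at hx hne ⊢
  exact h _ (ZMod.val_lt x) ((ecg_adj_natCast_iff hu (ZMod.val_lt x)).1 hx) fun e => hne (by rw [e])

theorem ecg_isZeroForcingSet {t k : ℕ} {Z : Set (ZMod (2 * t + 2 * k + 8))}
    (h₀ : ((0 : ℕ) : ZMod (2 * t + 2 * k + 8)) ∈ Z)
    (h₁ : ((t + 2 * k + 5 : ℕ) : ZMod (2 * t + 2 * k + 8)) ∈ Z)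
    (h₂ : ((t + 2 * k + 6 : ℕ) : ZMod (2 * t + 2 * k + 8)) ∈ Z)
    (h₃ : ((2 * t + 2 * k + 7 : ℕ) : ZMod (2 * t + 2 * k + 8)) ∈ Z) :
    IsZeroForcingSet (ECG t k) Z := by
  have f₂ := Forced.init (G := ECG t k) _ h₂
  have f₃ := Forced.init (G := ECG t k) _ h₃
  have ladder : ∀ i ≤ k + 1, ∀ x : ℕ,
      (x ≤ i ∨ t + 2 * k + 5 ≤ x + i ∧ x ≤ t + 2 * k + 5) → Forced (ECG t k) Z x := by
    intro i
    induction i with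
    | zero =>
      intro _ x hx
      obtain rfl | rfl : x = 0 ∨ x = t + 2 * k + 5 := by omega
      · exact .init _ h₀
      · exact .init _ h₁
    | succ i ih =>
      intro hi x hx
      have ih := ih (by omega)
      by_cases hold : x ≤ i ∨ t + 2 * k + 5 ≤ x + i ∧ x ≤ t + 2 * k + 5
      · exact ih x hold
      obtain rfl | hx' : x = i + 1 ∨ x + (i + 1) = t + 2 * k + 5 := by omega
      · refine forced_natCast_of_ecgRel (u := i) (by omega) (by omega) (ih i (by omega))
          (by unfold ecgRel; omega) fun y hlt hy hne => ?_
        unfold ecgRel at hy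
        by_cases h : y = 2 * t + 2 * k + 7
        · rwa [h]
        · exact ih y (by omega)
      · refine forced_natCast_of_ecgRel (u := x + 1) (by omega) (by omega)
          (ih (x + 1) (by omega)) (by unfold ecgRel; omega) fun y hlt hy hne => ?_
        unfold ecgRel at hy
        by_cases h : y = t + 2 * k + 6
        · rwa [h]
        · exact ih y (by omega)
  have ladder := ladder (k + 1) le_rfl
  have last : Forced (ECG t k) Z ((t + k + 3 : ℕ) : ZMod (2 * t + 2 * k + 8)) := by
    refine forced_natCast_of_ecgRel (u := t + k + 4) (by omega) (by omega)
      (ladder _ (by omega)) (by unfold ecgRel; omega) fun y hlt hy hne => ?_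
    unfold ecgRel at hy
    by_cases h : y = t + 2 * k + 6
    · rwa [h]
    · exact ladder y (by omega)
  have rest : ∀ j ≤ t + 1, ∀ x : ℕ,
      (x ≤ k + 2 + j ∨ t + k + 3 ≤ x ∧ x ≤ t + 2 * k + 6 ∨
        2 * t + 2 * k + 7 ≤ x + j ∧ x ≤ 2 * t + 2 * k + 7) → Forced (ECG t k) Z x := by
    intro j
    induction j with
    | zero =>
      intro _ x hx
      by_cases hl : x ≤ k + 1 ∨ t + 2 * k + 5 ≤ x + (k + 1) ∧ x ≤ t + 2 * k + 5
      · exact ladder x hl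
      obtain rfl | rfl | rfl | rfl : x = k + 2 ∨ x = t + k + 3 ∨ x = t + 2 * k + 6 ∨
        x = 2 * t + 2 * k + 7 := by omega
      · refine forced_natCast_of_ecgRel (u := k + 1) (by omega) (by omega)
          (ladder _ (by omega)) (by unfold ecgRel; omega) fun y hlt hy hne => ?_
        unfold ecgRel at hy
        exact ladder y (by omega)
      · exact last
      · exact f₂
      · exact f₃
    | succ j ih =>
      intro hj x hx
      have ih := ih (by omega)
      by_cases hold : x ≤ k + 2 + j ∨ t + k + 3 ≤ x ∧ x ≤ t + 2 * k + 6 ∨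
          2 * t + 2 * k + 7 ≤ x + j ∧ x ≤ 2 * t + 2 * k + 7
      · exact ih x hold
      obtain rfl | hx' : x = k + 2 + (j + 1) ∨ x + (j + 1) = 2 * t + 2 * k + 7 := by omega
      · refine forced_natCast_of_ecgRel (u := k + 2 + j) (by omega) (by omega)
          (ih _ (by omega)) (by unfold ecgRel; omega) fun y hlt hy hne => ?_
        unfold ecgRel at hy
        exact ih y (by omega)
      · refine forced_natCast_of_ecgRel (u := x + 1) (by omega) (by omega)
          (ih _ (by omega)) (by unfold ecgRel; omega) fun y hlt hy hne => ?_
        unfold ecgRel at hy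
        exact ih y (by omega)
  intro v
  rw [← ZMod.natCast_zmod_val v]
  have hv := ZMod.val_lt v
  exact rest (t + 1) le_rfl _ (by omega)

theorem zfn_le_ncard {G : SimpleGraph V} {Z : Set V} (h : IsZeroForcingSet G Z) :
    zfn G ≤ Z.ncard :=
  Nat.sInf_le ⟨Z, rfl, h⟩

theorem stmt9 (t k : ℕ) : zfn (ECG t k) ≤ 4 := by
  let Z : Finset (ZMod (2 * t + 2 * k + 8)) :=
    {((0 : ℕ) : ZMod (2 * t + 2 * k + 8)), ((t + 2 * k + 5 : ℕ) : ZMod (2 * t + 2 * k + 8)),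
      ((t + 2 * k + 6 : ℕ) : ZMod (2 * t + 2 * k + 8)),
      ((2 * t + 2 * k + 7 : ℕ) : ZMod (2 * t + 2 * k + 8))}
  have hZ : IsZeroForcingSet (ECG t k) (Z : Set (ZMod (2 * t + 2 * k + 8))) := by
    apply ecg_isZeroForcingSet <;> simp only [Z, Finset.mem_coe, Finset.mem_insert,
      Finset.mem_singleton, true_or, or_true]
  calc zfn (ECG t k) ≤ (Z : Set (ZMod (2 * t + 2 * k + 8))).ncard := zfn_le_ncard hZ
    _ = Z.card := Set.ncard_coe_finset Z
    _ ≤ 4 := Finset.card_le_four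

end Paper
end
end
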